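/- Let T be a basic or critical tile of dimension n with underlying simplex σ and restriction set R, and let θ be a face of σ of positive dimension, required not to be contained in R when T is critical. Then the stellar subdivision of T at θ carries a shellable h-tiling; moreover this h-tiling uses a critical tile if and only if T is critical, and in that case it uses exactly one critical tile, whose index equals the index of T. -/

import Mathlib

open Finset

variable {V : Type*} [DecidableEq V]

/-- A finite simplicial complex: a finite collection of finite sets of vertices
closed under taking subsets. -/
def IsComplex (K : Finset (Finset V)) : Prop :=
  ∀ σ ∈ K, ∀ τ ⊆ σ, τ ∈ K

/-- The set of nonempty faces of the relative simplicial complex `K ∖ L`. -/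
def relFaces (K L : Finset (Finset V)) : Finset (Finset V) :=
  (K \ L).filter (fun τ => τ ≠ ∅)

/-- A set `A` of faces is closed in `S`: every nonempty face of `S` contained in a
member of `A` belongs to `A`. -/
def closedIn (S A : Finset (Finset V)) : Prop :=
  ∀ τ ∈ S, τ ≠ ∅ → ∀ α ∈ A, τ ⊆ α → τ ∈ A

/-- A facet: a maximal face. -/
def IsFacetOf (K : Finset (Finset V)) (θ : Finset V) : Prop :=
  θ ∈ K ∧ ∀ σ ∈ K, θ ⊆ σ → σ = θ

instance (K : Finset (Finset V)) (θ : Finset V) : Decidable (IsFacetOf K θ) :=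
  inferInstanceAs (Decidable (θ ∈ K ∧ ∀ σ ∈ K, θ ⊆ σ → σ = θ))

/-- A ridge: a face of codimension one in every facet containing it. -/
def IsRidgeOf (K : Finset (Finset V)) (θ : Finset V) : Prop :=
  θ ∈ K ∧ ∀ σ, IsFacetOf K σ → θ ⊆ σ → σ.card = θ.card + 1

/-- Stellar subdivision of `K` at the face `θ`, using the new vertex `v`. -/
def stellar (K : Finset (Finset V)) (θ : Finset V) (v : V) : Finset (Finset V) :=
  K.filter (fun σ => ¬ θ ⊆ σ) ∪
    (K.filter (fun ρ => ¬ θ ⊆ ρ ∧ ρ ∪ θ ∈ K)).image (fun ρ => insert v ρ)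

/-- Barycentric subdivision: faces are the chains of nonempty faces of `K`. -/
def barySd (K : Finset (Finset V)) : Finset (Finset (Finset V)) :=
  K.powerset.filter (fun c => ∅ ∉ c ∧ ∀ τ ∈ c, ∀ τ' ∈ c, τ ⊆ τ' ∨ τ' ⊆ τ)

/-- A Morse tile: a simplex `simplex` deprived of the ridges not containing `res`,
together possibly with a Morse face `morse` of higher codimension. -/
structure MorseTile (V : Type*) where
  simplex : Finset V
  res : Finset V
  morse : Option (Finset V)
  simplex_nonempty : simplex.Nonempty
  res_sub : res ⊆ simplex
  morse_res : ∀ μ ∈ morse, res ⊆ μ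
  morse_ssub : ∀ μ ∈ morse, μ ⊂ simplex
  morse_card : ∀ μ ∈ morse, μ.card + 2 ≤ simplex.card

namespace MorseTile

/-- The face set of a Morse tile. -/
def faceSet (T : MorseTile V) : Finset (Finset V) :=
  match T.morse with
  | none => T.simplex.powerset.filter (fun τ => T.res ⊆ τ ∧ τ ≠ ∅)
  | some μ => T.simplex.powerset.filter (fun τ => T.res ⊆ τ ∧ ¬ τ ⊆ μ)

/-- The dimension of a Morse tile. -/
def dim (T : MorseTile V) : ℕ := T.simplex.card - 1

/-- The order of a Morse tile. -/
def order (T : MorseTile V) : ℕ := T.res.card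

/-- The index of a (critical) Morse tile. -/
def index (T : MorseTile V) : ℕ :=
  if T.res = T.simplex then T.simplex.card - 1 else T.res.card

/-- Basic tiles: no Morse face. -/
def IsBasic (T : MorseTile V) : Prop := T.morse = none

/-- Critical tiles: the Morse face equals the restriction set, or the open simplex. -/
def IsCritical (T : MorseTile V) : Prop := T.morse = some T.res ∨ T.res = T.simplex

/-- Tiles allowed in an h-tiling: basic or critical tiles. -/
def IsHTile (T : MorseTile V) : Prop := T.morse = none ∨ T.morse = some T.res

/-- The closed simplex. -/
def IsClosedSimplex (T : MorseTile V) : Prop := T.morse = none ∧ T.res = ∅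

/-- The open simplex. -/
def IsOpenSimplex (T : MorseTile V) : Prop := T.morse = none ∧ T.res = T.simplex

instance (T : MorseTile V) : Decidable T.IsCritical :=
  inferInstanceAs (Decidable (T.morse = some T.res ∨ T.res = T.simplex))

/-- Isomorphism of Morse tiles: a bijection between the underlying simplices mapping
the face set of one onto the face set of the other. -/
def Isom (T T' : MorseTile V) : Prop :=
  ∃ e : V → V, Set.InjOn e (T.simplex : Set V) ∧ T.simplex.image e = T'.simplex ∧
    T.faceSet.image (fun τ => τ.image e) = T'.faceSet

/-- The subcomplex `L_T` of removed faces of a Morse tile. -/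
def removed (T : MorseTile V) : Finset (Finset V) :=
  T.simplex.powerset.filter (fun τ => τ ∉ T.faceSet)

/-- The stellar subdivision of a Morse tile at a face `θ` of its underlying simplex,
as a relative simplicial complex. -/
def stellarSub (T : MorseTile V) (θ : Finset V) (v : V) : Finset (Finset V) :=
  relFaces (stellar T.simplex.powerset θ v) (stellar T.removed θ v)

end MorseTile

/-- The union of the face sets of a list of Morse tiles. -/
def faceUnion (ts : List (MorseTile V)) : Finset (Finset V) :=
  ts.foldr (fun T A => T.faceSet ∪ A) ∅

/-- A Morse tiling of the set `S` of nonempty faces of a relative complex: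
the face sets of the tiles partition `S`, and for every `d` the union of the
face sets of the tiles of dimension at least `d` is closed in `S`. -/
def IsMorseTiling (S : Finset (Finset V)) (ts : List (MorseTile V)) : Prop :=
  ts.Pairwise (fun T T' => Disjoint T.faceSet T'.faceSet) ∧
  faceUnion ts = S ∧
  ∀ d : ℕ, closedIn S (faceUnion (ts.filter (fun T => decide (d ≤ T.dim))))

/-- A Morse shelling: a Morse tiling whose order makes every initial union closed. -/
def IsMorseShelling (S : Finset (Finset V)) (ts : List (MorseTile V)) : Prop :=
  IsMorseTiling S ts ∧ ∀ p : ℕ, closedIn S (faceUnion (ts.take p))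

/-- An h-tiling: a Morse tiling all of whose tiles are basic or critical. -/
def IsHTiling (S : Finset (Finset V)) (ts : List (MorseTile V)) : Prop :=
  IsMorseTiling S ts ∧ ∀ T ∈ ts, T.IsHTile

/-- A shellable (shelled) h-tiling. -/
def IsHShelling (S : Finset (Finset V)) (ts : List (MorseTile V)) : Prop :=
  IsMorseShelling S ts ∧ ∀ T ∈ ts, T.IsHTile

/-- The number of critical tiles of index `k`. -/
def criticalCount (ts : List (MorseTile V)) (k : ℕ) : ℕ :=
  ts.countP (fun T => decide (T.IsCritical ∧ T.index = k))

/-- The total number of critical tiles. -/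
def totalCritical (ts : List (MorseTile V)) : ℕ :=
  ts.countP (fun T => decide T.IsCritical)

/-- The number of tiles of order `k`. -/
def hCount (ts : List (MorseTile V)) (k : ℕ) : ℕ :=
  ts.countP (fun T => decide (T.order = k))

/-- The number of `k`-dimensional faces. -/
def fCount (S : Finset (Finset V)) (k : ℕ) : ℕ :=
  (S.filter (fun τ => τ.card = k + 1)).card

/-- The Euler characteristic of a set of nonempty faces. -/
def eulerChar (S : Finset (Finset V)) : ℤ :=
  ∑ τ ∈ S, (-1 : ℤ) ^ (τ.card - 1)

/-- A pure `n`-dimensional complex: it has an `n`-dimensional face and all its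
facets have dimension `n`. -/
def IsPureDim (n : ℕ) (K : Finset (Finset V)) : Prop :=
  (∃ σ ∈ K, σ.card = n + 1) ∧ ∀ θ, IsFacetOf K θ → θ.card = n + 1

/-- A closed `n`-dimensional pseudo-manifold: a pure `n`-dimensional complex in
which every `(n-1)`-dimensional face is contained in exactly two facets. -/
def IsPseudoManifold (n : ℕ) (K : Finset (Finset V)) : Prop :=
  IsComplex K ∧ IsPureDim n K ∧
  ∀ ρ ∈ K, ρ.card = n → (K.filter (fun σ => IsFacetOf K σ ∧ ρ ⊆ σ)).card = 2

/-- Strong connectedness: any two facets are joined by a sequence of facets in which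
consecutive ones share an `(n-1)`-dimensional face. -/
def StronglyConnected (n : ℕ) (K : Finset (Finset V)) : Prop :=
  ∀ σ σ', IsFacetOf K σ → IsFacetOf K σ' →
    ∃ (m : ℕ) (c : ℕ → Finset V), c 0 = σ ∧ c m = σ' ∧
      (∀ i ≤ m, IsFacetOf K (c i)) ∧
      ∀ i < m, ∃ ρ : Finset V, ρ.card = n ∧ ρ ⊆ c i ∧ ρ ⊆ c (i + 1)

/-- Classical shellability of a finite simplicial complex. -/
def ClassicallyShellable (K : Finset (Finset V)) : Prop :=
  ∃ (N : ℕ) (f : Fin N → Finset V), Function.Injective f ∧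
    (∀ σ, IsFacetOf K σ ↔ ∃ i, f i = σ) ∧
    ∀ p : Fin N, 0 < (p : ℕ) →
      ∃ R : Finset V, R ≠ ∅ ∧ R ⊆ f p ∧
        ∀ τ : Finset V,
          ((τ ≠ ∅ ∧ τ ⊆ f p ∧ ∀ q, q < p → ¬ τ ⊆ f q) ↔ (R ⊆ τ ∧ τ ⊆ f p))

theorem mem_faceUnion {ts : List (MorseTile V)} {F : Finset V} :
    F ∈ faceUnion ts ↔ ∃ T ∈ ts, F ∈ T.faceSet := by
  induction ts with
  | nil => simp [faceUnion]
  | cons T ts ih =>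
    have : faceUnion (T :: ts) = T.faceSet ∪ faceUnion ts := rfl
    simp [this, ih]

/-- An h-tile of order `k` consists of the nonempty faces containing its restriction set,
the latter being left out when there is a Morse face. -/
theorem MorseTile.IsHTile.mem_faceSet {T : MorseTile V} (hT : T.IsHTile) {F : Finset V} :
    F ∈ T.faceSet ↔
      F ⊆ T.simplex ∧ T.res ⊆ F ∧ F ≠ ∅ ∧ (T.morse ≠ none → F ≠ T.res) := by
  rcases hT with h | h
  · simp [MorseTile.faceSet, h]
  · simp only [MorseTile.faceSet, h, mem_filter, mem_powerset, ne_eq, reduceCtorEq,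
      not_false_eq_true, forall_const]
    refine and_congr_right fun _ => and_congr_right fun hR => ⟨fun hF => ⟨?_, ?_⟩, ?_⟩
    · rintro rfl
      exact hF (empty_subset _)
    · rintro rfl
      exact hF Subset.rfl
    · exact fun hF hle => hF.2 (hle.antisymm hR)

/-- The nonempty faces of the stellar subdivision of an h-tile. -/
theorem MorseTile.IsHTile.mem_stellarSub {T : MorseTile V} (hT : T.IsHTile) {θ : Finset V}
    (hθ : θ ⊆ T.simplex) (hcrit : T.IsCritical → ¬ θ ⊆ T.res) {v : V} (hv : v ∉ T.simplex)
    {F : Finset V} :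
    F ∈ T.stellarSub θ v ↔
      F ≠ ∅ ∧ F ⊆ insert v T.simplex ∧ ¬ θ ⊆ F ∧ T.res \ θ ⊆ F ∧
        (v ∉ F → T.res ⊆ F ∧ (T.morse ≠ none → F ≠ T.res)) := by
  have hvθ : v ∉ θ := fun h => hv (hθ h)
  have hmorse : T.morse ≠ none → ¬ θ ⊆ T.res := fun h =>
    hcrit (.inl (hT.resolve_left h))
  have hrem (G : Finset V) : G ∈ T.removed ↔ G ⊆ T.simplex ∧
      ¬ (T.res ⊆ G ∧ G ≠ ∅ ∧ (T.morse ≠ none → G ≠ T.res)) := by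
    rw [MorseTile.removed, mem_filter, mem_powerset, hT.mem_faceSet]
    tauto
  have hst (K : Finset (Finset V)) (hK : ∀ G ∈ K, G ⊆ T.simplex) : F ∈ stellar K θ v ↔
      ¬ θ ⊆ F ∧ ((v ∉ F ∧ F ∈ K) ∨ (v ∈ F ∧ F.erase v ∈ K ∧ F.erase v ∪ θ ∈ K)) := by
    simp only [stellar, mem_union, mem_filter, mem_image]
    constructor
    · rintro (⟨h, h'⟩ | ⟨ρ, ⟨h, h1, h2⟩, rfl⟩)
      · exact ⟨h', .inl ⟨fun hvF => hv (hK _ h hvF), h⟩⟩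
      · have hvρ : v ∉ ρ := fun hvF => hv (hK _ h hvF)
        rw [erase_insert hvρ]
        refine ⟨fun hs => h1 ((subset_insert_iff_of_notMem hvθ).1 hs), .inr ?_⟩
        exact ⟨mem_insert_self _ _, h, h2⟩
    · rintro ⟨h, ⟨_, h'⟩ | ⟨h1, h2, h3⟩⟩
      · exact .inl ⟨h', h⟩
      · exact .inr ⟨_, ⟨h2, fun hs => h (hs.trans (erase_subset _ _)), h3⟩, insert_erase h1⟩
  have hremK : ∀ G ∈ T.removed, G ⊆ T.simplex := fun G hG => ((hrem G).1 hG).1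
  rw [MorseTile.stellarSub, relFaces, mem_filter, mem_sdiff,
    hst _ (fun G hG => mem_powerset.1 hG), hst _ hremK, hrem, hrem, hrem, mem_powerset,
    mem_powerset, mem_powerset]
  by_cases hvF : v ∈ F
  · have e1 : F ⊆ insert v T.simplex ↔ F.erase v ⊆ T.simplex := subset_insert_iff
    have e2 : T.res ⊆ F.erase v ∪ θ ↔ T.res \ θ ⊆ F := by
      constructor
      · intro h x hx
        have := h (mem_sdiff.1 hx).1
        simp_all
      · intro h x hx
        by_cases hxθ : x ∈ θ
        · simp [hxθ]
        · have hxv : x ≠ v := fun e => hv (e ▸ T.res_sub hx)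
          simp [hxv, h (mem_sdiff.2 ⟨hx, hxθ⟩)]
    have e3 : F.erase v ∪ θ ⊆ T.simplex ↔ F.erase v ⊆ T.simplex :=
      ⟨fun h => subset_union_left.trans h, fun h => union_subset h hθ⟩
    have e4 : F ≠ ∅ := ne_empty_of_mem hvF
    rw [← e2, e1, e3]
    by_cases hθF : θ ⊆ F
    · simp [hθF]
    by_cases hR : T.res ⊆ F.erase v ∪ θ
    · have e5 : F.erase v ∪ θ ≠ ∅ := fun e =>
        hθF ((union_eq_empty.1 e).2 ▸ empty_subset _)
      have e6 : T.morse ≠ none → F.erase v ∪ θ ≠ T.res := fun h e =>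
        hmorse h (e ▸ subset_union_right)
      simp only [hvF, hθF, hR, and_iff_right e5, iff_true_intro e6]
      simp [e4]
    · have e5 : ¬ T.res ⊆ F.erase v := fun h => hR (h.trans subset_union_left)
      simp [hvF, hθF, hR, e4, e5]
  · rw [subset_insert_iff_of_notMem hvF]
    have e : T.res ⊆ F → T.res \ θ ⊆ F := fun h => sdiff_subset.trans h
    simp only [hvF, not_false_eq_true, true_and, false_and, or_false, true_implies]
    constructor
    · rintro ⟨⟨⟨h1, h2⟩, h3⟩, h4⟩
      have h5 := not_not.1 fun h => h3 ⟨h1, h2, h⟩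
      exact ⟨h4, h2, h1, e h5.1, h5.1, h5.2.2⟩
    · rintro ⟨h4, h2, h1, -, h5, h6⟩
      exact ⟨⟨⟨h1, h2⟩, fun h => h.2.2 ⟨h5, h4, h6⟩⟩, h4⟩

/-- A set of faces, each missing some vertex of a list `l`, is shelled by tiles of the same
dimension which sort the faces by the first vertex of `l` that they miss. -/
theorem isMorseShelling_map_of_first_missing {S : Finset (Finset V)} {l : List V}
    (hl : l.Nodup) (T : V → MorseTile V) {n : ℕ} (hdim : ∀ i ∈ l, (T i).dim = n)
    (hS : ∀ F ∈ S, ∃ i ∈ l, i ∉ F)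
    (hT : ∀ i ∈ l, ∀ F, F ∈ (T i).faceSet ↔
      F ∈ S ∧ i ∉ F ∧ ∀ j ∈ l, l.idxOf j < l.idxOf i → j ∈ F) :
    IsMorseShelling S (l.map T) := by
  have hfirst (F : Finset V) (hF : F ∈ S) (i : V) (hi : i ∈ l) (hiF : i ∉ F) :
      ∃ j ∈ l, l.idxOf j ≤ l.idxOf i ∧ F ∈ (T j).faceSet := by
    obtain ⟨j, hj, hmin⟩ := exists_min_image (l.toFinset.filter (· ∉ F)) l.idxOf
      ⟨i, by simp [hi, hiF]⟩
    simp only [mem_filter, List.mem_toFinset] at hj hmin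
    refine ⟨j, hj.1, hmin i ⟨hi, hiF⟩, (hT j hj.1 F).2 ⟨hF, hj.2, fun k hk hlt => ?_⟩⟩
    by_contra hkF
    exact absurd (hmin k ⟨hk, hkF⟩) (by omega)
  have hunion : faceUnion (l.map T) = S := by
    ext F
    simp only [mem_faceUnion, List.mem_map, exists_exists_and_eq_and]
    constructor
    · rintro ⟨i, hi, hF⟩
      exact ((hT i hi F).1 hF).1
    · intro hF
      obtain ⟨i, hi, hiF⟩ := hS F hF
      obtain ⟨j, hj, -, h⟩ := hfirst F hF i hi hiF
      exact ⟨j, hj, h⟩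
  refine ⟨⟨?_, hunion, fun d => ?_⟩, fun p => ?_⟩
  · rw [List.pairwise_map]
    refine hl.imp_of_mem fun {a b} ha hb hab => disjoint_left.2 fun F hFa hFb => ?_
    have h1 := (hT a ha F).1 hFa
    have h2 := (hT b hb F).1 hFb
    rcases lt_trichotomy (l.idxOf a) (l.idxOf b) with h | h | h
    · exact h1.2.1 (h2.2.2 a ha h)
    · exact hab ((List.idxOf_inj ha).1 h)
    · exact h2.2.1 (h1.2.2 b hb h)
  · by_cases hd : d ≤ n
    · rw [List.filter_eq_self.2, hunion]
      · exact fun F hF _ _ _ _ => hF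
      · simpa using fun i hi => (hdim i hi).symm ▸ hd
    · rw [List.filter_eq_nil_iff.2]
      · intro F _ _ α hα
        simp [faceUnion] at hα
      · simpa using fun i hi => (hdim i hi).symm ▸ (not_le.1 hd)
  · intro F hF _ α hα hFα
    simp only [← List.map_take, mem_faceUnion, List.mem_map, exists_exists_and_eq_and] at hα ⊢
    obtain ⟨i, hi, hαi⟩ := hα
    have hil := List.mem_of_mem_take hi
    obtain ⟨j, hj, hji, hFj⟩ := hfirst F hF i hil fun h => ((hT i hil α).1 hαi).2.1 (hFα h)
    refine ⟨j, (List.mem_take_iff_idxOf_lt hj).2 ?_, hFj⟩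
    exact hji.trans_lt ((List.mem_take_iff_idxOf_lt hil).1 hi)

/-- The elements of a finite set can be listed so that those of `R` come first. -/
theorem exists_list_inter_first (θ R : Finset V) :
    ∃ l : List V, l.Nodup ∧ (∀ i, i ∈ l ↔ i ∈ θ) ∧
      ∀ i ∈ l, ∀ j ∈ l, i ∈ R → j ∉ R → l.idxOf i < l.idxOf j := by
  refine ⟨(θ ∩ R).toList ++ (θ \ R).toList, ?_, ?_, ?_⟩
  · rw [List.nodup_append']
    refine ⟨nodup_toList _, nodup_toList _, fun i hi hj => ?_⟩
    simp only [mem_toList, mem_inter, mem_sdiff] at hi hj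
    exact hj.2 hi.2
  · intro i
    simp only [List.mem_append, mem_toList, mem_inter, mem_sdiff]
    tauto
  · intro i hi j hj hiR hjR
    have hi' : i ∈ (θ ∩ R).toList := by simp_all
    have hj' : j ∉ (θ ∩ R).toList := by simp_all
    rw [List.idxOf_append_of_mem hi', List.idxOf_append_of_notMem hj']
    exact (List.idxOf_lt_length_of_mem hi').trans_le (Nat.le_add_right _ _)

/-- The tile on the facet of the stellar subdivision missing `i`, where `P` is the set of
vertices of `θ` preceding `i`. -/
theorem MorseTile.exists_stellar_tile (T : MorseTile V) (hT : T.IsHTile) {θ : Finset V}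
    (hθ : θ ⊆ T.simplex) {v : V} (hv : v ∉ T.simplex) {i : V} (hi : i ∈ θ) {P : Finset V}
    (hP : P ⊆ θ) (hiP : i ∉ P) :
    ∃ C : MorseTile V, C.simplex = insert v (T.simplex.erase i) ∧
      C.res = (if i ∈ T.res then insert v (P ∪ T.res \ θ) else P ∪ T.res \ θ) ∧
      C.morse = if i ∉ T.res ∧ P = T.res ∩ θ then T.morse else none := by
  have hres : (if i ∈ T.res then insert v (P ∪ T.res \ θ) else P ∪ T.res \ θ) ⊆
      insert v (T.simplex.erase i) := by
    have h : P ∪ T.res \ θ ⊆ T.simplex.erase i := by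
      intro x hx
      rw [mem_union, mem_sdiff] at hx
      refine mem_erase.2 ⟨?_, ?_⟩
      · rintro rfl
        tauto
      · exact hx.elim (fun h => hθ (hP h)) fun h => T.res_sub h.1
    split_ifs
    · exact insert_subset_insert _ h
    · exact h.trans (subset_insert _ _)
  have hcard : (insert v (T.simplex.erase i)).card = T.simplex.card := by
    rw [card_insert_of_notMem fun h => hv (mem_of_mem_erase h), card_erase_add_one (hθ hi)]
  have hmorse : ∀ μ ∈ (if i ∉ T.res ∧ P = T.res ∩ θ then T.morse else none),
      i ∉ T.res ∧ P = T.res ∩ θ ∧ T.morse = some μ ∧ μ = T.res := by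
    intro μ hμ
    split_ifs at hμ with h
    · rw [Option.mem_def] at hμ
      refine ⟨h.1, h.2, hμ, ?_⟩
      rcases hT with h' | h' <;> simp_all
    · simp at hμ
  refine ⟨⟨_, _, _, insert_nonempty _ _, hres, fun μ hμ => ?_, fun μ hμ => ?_,
    fun μ hμ => ?_⟩, rfl, rfl, rfl⟩
  all_goals obtain ⟨hiR, rfl, hm, rfl⟩ := hmorse μ hμ
  · rw [if_neg hiR, union_comm, sdiff_union_inter]
  · refine (ssubset_iff_of_subset fun x hx => ?_).2
      ⟨v, mem_insert_self _ _, fun h => hv (T.res_sub h)⟩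
    refine mem_insert_of_mem (mem_erase.2 ⟨?_, T.res_sub hx⟩)
    rintro rfl
    exact hiR hx
  · rw [hcard]
    exact T.morse_card _ hm

/-- stellar subdivision of a basic or critical tile at a face not
contained in the restriction set when the tile is critical. -/
theorem stellar_subdivision_of_basic_or_critical_tile {V : Type*} [DecidableEq V]
    (T : MorseTile V) (hT : T.IsHTile)
    (θ : Finset V) (hθ : θ ⊆ T.simplex) (hθdim : 2 ≤ θ.card)
    (hcrit : T.IsCritical → ¬ θ ⊆ T.res)
    (v : V) (hv : v ∉ T.simplex) :
    ∃ ts : List (MorseTile V),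
      IsHShelling (T.stellarSub θ v) ts ∧
      ((∃ T' ∈ ts, T'.IsCritical) ↔ T.IsCritical) ∧
      (T.IsCritical → ∃ C ∈ ts, C.IsCritical ∧ C.index = T.index ∧
        ∀ T' ∈ ts, T'.IsCritical → T' = C) := by
  have hmorse : T.morse ≠ none → ¬ θ ⊆ T.res := fun h =>
    hcrit (.inl (hT.resolve_left h))
  have hcrit' : T.IsCritical ↔ T.morse = some T.res :=
    ⟨fun h => h.resolve_right fun e => hcrit h (e ▸ hθ), .inl⟩
  obtain ⟨l, hl, hlθ, hlR⟩ := exists_list_inter_first θ T.res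
  let P (i : V) : Finset V := θ.filter fun j => l.idxOf j < l.idxOf i
  have hPθ (i : V) : P i ⊆ θ := filter_subset _ _
  have hiP (i : V) : i ∉ P i := by simp [P]
  have hPR {i : V} (hi : i ∈ θ) (hiR : i ∈ T.res) : P i ⊆ T.res := by
    intro j hj
    obtain ⟨hj, hlt⟩ := mem_filter.1 hj
    by_contra hjR
    exact absurd (hlR i ((hlθ i).2 hi) j ((hlθ j).2 hj) hiR hjR) (by omega)
  have hRP {i : V} (hi : i ∈ θ) (hiR : i ∉ T.res) : T.res ∩ θ ⊆ P i := by
    intro j hj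
    obtain ⟨hjR, hj⟩ := mem_inter.1 hj
    exact mem_filter.2 ⟨hj, hlR j ((hlθ j).2 hj) i ((hlθ i).2 hi) hjR hiR⟩
  have hex (i : V) : ∃ C : MorseTile V, i ∈ θ → C.simplex = insert v (T.simplex.erase i) ∧
      C.res = (if i ∈ T.res then insert v (P i ∪ T.res \ θ) else P i ∪ T.res \ θ) ∧
      C.morse = if i ∉ T.res ∧ P i = T.res ∩ θ then T.morse else none := by
    by_cases hi : i ∈ θ
    · obtain ⟨C, hC⟩ := T.exists_stellar_tile hT hθ hv hi (hPθ i) (hiP i)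
      exact ⟨C, fun _ => hC⟩
    · exact ⟨T, fun h => absurd h hi⟩
  choose C hC using hex
  have hres {i : V} (h : P i = T.res ∩ θ) : P i ∪ T.res \ θ = T.res := by
    rw [h, union_comm, sdiff_union_inter]
  have hCT {i : V} (hi : i ∈ θ) : (C i).IsHTile := by
    obtain ⟨-, h2, h3⟩ := hC i hi
    by_cases h : i ∉ T.res ∧ P i = T.res ∩ θ
    · rw [if_pos h] at h3
      rw [if_neg h.1, hres h.2] at h2
      rw [MorseTile.IsHTile, h2, h3]
      exact hT
    · exact .inl (h3.trans (if_neg h))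
  have hnot {i : V} (hi : i ∈ θ) : (C i).res ≠ (C i).simplex := by
    obtain ⟨h1, h2, -⟩ := hC i hi
    rw [h1, h2]
    intro e
    by_cases hiR : i ∈ T.res
    · rw [if_pos hiR] at e
      have hsub : T.simplex ⊆ T.res := by
        intro x hx
        by_cases hxi : x = i
        · exact hxi ▸ hiR
        have hx' : x ∈ insert v (P i ∪ T.res \ θ) :=
          e ▸ mem_insert_of_mem (mem_erase.2 ⟨hxi, hx⟩)
        rcases mem_insert.1 hx' with rfl | hx'
        · exact absurd hx hv
        · exact (mem_union.1 hx').elim (fun h => hPR hi hiR h) fun h => (mem_sdiff.1 h).1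
      exact hcrit (.inr (T.res_sub.antisymm hsub)) (hθ.trans hsub)
    · rw [if_neg hiR] at e
      have hvm : v ∈ P i ∪ T.res \ θ := e ▸ mem_insert_self _ _
      exact hv ((mem_union.1 hvm).elim (fun h => hθ (hPθ i h))
        fun h => T.res_sub (mem_sdiff.1 h).1)
  have hCcrit {i : V} (hi : i ∈ θ) : (C i).IsCritical ↔
      T.IsCritical ∧ i ∉ T.res ∧ P i = T.res ∩ θ := by
    obtain ⟨-, h2, h3⟩ := hC i hi
    rw [MorseTile.IsCritical, or_iff_left (hnot hi), hcrit']
    by_cases h : i ∉ T.res ∧ P i = T.res ∩ θ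
    · rw [h3, if_pos h, h2, if_neg h.1, hres h.2]
      tauto
    · rw [h3, if_neg h]
      simp [h]
  have hfaces : ∀ i ∈ l, ∀ F, F ∈ (C i).faceSet ↔
      F ∈ T.stellarSub θ v ∧ i ∉ F ∧ ∀ j ∈ l, l.idxOf j < l.idxOf i → j ∈ F := by
    intro i hil F
    have hi := (hlθ i).1 hil
    obtain ⟨h1, h2, h3⟩ := hC i hi
    have hpre : (∀ j ∈ l, l.idxOf j < l.idxOf i → j ∈ F) ↔ P i ⊆ F := by
      simp [P, subset_iff, hlθ]
    have hiv : i ≠ v := fun e => hv (e ▸ hθ hi)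
    have hsub : F ⊆ insert v (T.simplex.erase i) ↔ F ⊆ insert v T.simplex ∧ i ∉ F := by
      rw [← erase_insert_of_ne hiv.symm, subset_erase]
    have hmiss : i ∉ F → ¬ θ ⊆ F := fun h h' => h (h' hi)
    rw [(hCT hi).mem_faceSet, hT.mem_stellarSub hθ hcrit hv, hpre, h1, h2, h3, hsub]
    by_cases hiR : i ∈ T.res
    · have : i ∉ F → ¬ T.res ⊆ F := fun h h' => h (h' hiR)
      simp only [hiR, not_true_eq_false, false_and, if_true, if_false, insert_subset_iff,
        union_subset_iff, ne_eq]
      constructor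
      · rintro ⟨⟨h1, h2⟩, ⟨h3, h4, h5⟩, h6, -⟩
        exact ⟨⟨h6, h1, hmiss h2, h5, fun h => absurd h3 h⟩, h2, h4⟩
      · rintro ⟨⟨h6, h1, -, h5, h3⟩, h2, h4⟩
        have hvF : v ∈ F := not_not.1 fun h => this h2 (h3 h).1
        exact ⟨⟨h1, h2⟩, ⟨hvF, h4, h5⟩, h6, fun h => h.elim⟩
    · have hRF : P i ∪ T.res \ θ ⊆ F → T.res ⊆ F := fun h =>
        fun x hx => h <| by
          by_cases hxθ : x ∈ θ
          · exact mem_union_left _ (hRP hi hiR (mem_inter.2 ⟨hx, hxθ⟩))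
          · exact mem_union_right _ (mem_sdiff.2 ⟨hx, hxθ⟩)
      have hvR : v ∈ F → F ≠ T.res := fun h e => hv (T.res_sub (e ▸ h))
      have hne : P i ≠ T.res ∩ θ → P i ⊆ F → F ≠ T.res := by
        rintro hPi h rfl
        exact hPi (Subset.antisymm (subset_inter h (hPθ i)) (hRP hi hiR))
      rw [if_neg hiR]
      constructor
      · rintro ⟨⟨h1, h2⟩, h3, h4, h5⟩
        obtain ⟨h6, h7⟩ := union_subset_iff.1 h3
        refine ⟨⟨h4, h1, hmiss h2, h7, fun _ => ⟨hRF h3, fun hm => ?_⟩⟩, h2, h6⟩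
        by_cases hPi : P i = T.res ∩ θ
        · rw [if_pos ⟨hiR, hPi⟩, hres hPi] at h5
          exact h5 hm
        · exact hne hPi h6
      · rintro ⟨⟨h4, h1, -, h7, h8⟩, h2, h6⟩
        refine ⟨⟨h1, h2⟩, union_subset h6 h7, h4, fun hm => ?_⟩
        by_cases hPi : P i = T.res ∩ θ
        · rw [if_pos ⟨hiR, hPi⟩] at hm
          rw [hres hPi]
          by_cases hvF : v ∈ F
          · exact hvR hvF
          · exact (h8 hvF).2 hm
        · exact absurd (if_neg fun h => hPi h.2) hm
  have hdim : ∀ i ∈ l, (C i).dim = T.simplex.card - 1 := by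
    intro i hil
    have hi := (hlθ i).1 hil
    rw [MorseTile.dim, (hC i hi).1, card_insert_of_notMem fun h => hv (mem_of_mem_erase h),
      card_erase_add_one (hθ hi)]
  have hmissing : ∀ F ∈ T.stellarSub θ v, ∃ i ∈ l, i ∉ F := by
    intro F hF
    obtain ⟨i, hi, hiF⟩ := not_subset.1 ((hT.mem_stellarSub hθ hcrit hv).1 hF).2.2.1
    exact ⟨i, (hlθ i).2 hi, hiF⟩
  have hexcrit : T.IsCritical → ∃ i ∈ θ, i ∉ T.res ∧ P i = T.res ∩ θ := by
    intro h
    obtain ⟨k, hk, hkR⟩ := not_subset.1 (hcrit h)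
    obtain ⟨i, hi, hmin⟩ := exists_min_image (θ \ T.res) l.idxOf ⟨k, mem_sdiff.2 ⟨hk, hkR⟩⟩
    obtain ⟨hiθ, hiR⟩ := mem_sdiff.1 hi
    refine ⟨i, hiθ, hiR, Subset.antisymm (fun j hj => ?_) (hRP hiθ hiR)⟩
    obtain ⟨hj, hlt⟩ := mem_filter.1 hj
    refine mem_inter.2 ⟨?_, hj⟩
    by_contra hjR
    exact absurd (hmin j (mem_sdiff.2 ⟨hj, hjR⟩)) (by omega)
  refine ⟨l.map C, ⟨isMorseShelling_map_of_first_missing hl C hdim hmissing hfaces, ?_⟩, ?_, ?_⟩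
  · simpa [hlθ] using fun i hi => hCT hi
  · simp only [List.mem_map, exists_exists_and_eq_and, hlθ]
    constructor
    · rintro ⟨i, hi, h⟩
      exact ((hCcrit hi).1 h).1
    · intro h
      obtain ⟨i, hi, hi'⟩ := hexcrit h
      exact ⟨i, hi, (hCcrit hi).2 ⟨h, hi'⟩⟩
  · intro h
    obtain ⟨i, hi, hiR, hPi⟩ := hexcrit h
    refine ⟨C i, List.mem_map_of_mem ((hlθ i).2 hi), (hCcrit hi).2 ⟨h, hiR, hPi⟩, ?_, ?_⟩
    · have hTne : T.res ≠ T.simplex := fun e => hcrit h (e ▸ hθ)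
      rw [MorseTile.index, if_neg (hnot hi), MorseTile.index, if_neg hTne, (hC i hi).2.1,
        if_neg hiR, hres hPi]
    · simp only [List.mem_map, forall_exists_index, and_imp, forall_apply_eq_imp_iff₂, hlθ]
      intro j hj hjC
      obtain ⟨-, hjR, hPj⟩ := (hCcrit hj).1 hjC
      have hle {a b : V} (ha : a ∈ θ) (haR : a ∉ T.res) (hPb : P b = T.res ∩ θ) :
          l.idxOf b ≤ l.idxOf a := by
        by_contra hlt
        have hab : a ∈ P b := mem_filter.2 ⟨ha, by omega⟩
        exact haR (mem_inter.1 (hPb ▸ hab)).1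
      have hidx := (hle hi hiR hPj).antisymm (hle hj hjR hPi)
      rw [(List.idxOf_inj ((hlθ j).2 hj)).1 hidx]
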